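/- Let C = (c₁,…,c_t) with 0 < cᵢ ≤ 1, and G, G' probability vectors with g'ᵢ > 0. Let c_min = min C and c_max = max C. Then there exists a vector C̃ whose entries all lie in {c_min, c_max} such that (C̃ᵀG)/(C̃ᵀG') ≥ (CᵀG)/(CᵀG'). In particular, the maximum of F(C) = CᵀG/CᵀG' over vectors with entries in [c_min, c_max] is attained at a vector with entries in {c_min, c_max}. -/

import Mathlib

open Finset

theorem boundary_aux {t : ℕ} [NeZero t] (a b : ℝ) (ha : 0 < a) (D g g' : Fin t → ℝ)
    (hg'pos : ∀ i, 0 < g' i) (hD : ∀ i, D i ∈ Set.Icc a b) :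
    ∃ Ct : Fin t → ℝ, (∀ i, Ct i = a ∨ Ct i = b) ∧
      (∑ i, D i * g i) / (∑ i, D i * g' i) ≤
        (∑ i, Ct i * g i) / (∑ i, Ct i * g' i) := by
  have hb : 0 < b := lt_of_lt_of_le ha ((hD 0).1.trans (hD 0).2)
  have hDpos : 0 < ∑ i, D i * g' i :=
    Finset.sum_pos (fun i _ => mul_pos (lt_of_lt_of_le ha (hD i).1) (hg'pos i))
      Finset.univ_nonempty
  obtain ⟨l, hl⟩ : ∃ l, l = (∑ i, D i * g i) / (∑ i, D i * g' i) := ⟨_, rfl⟩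
  have hl' : l * (∑ i, D i * g' i) = ∑ i, D i * g i := by
    rw [hl]; exact div_mul_cancel₀ _ hDpos.ne'
  rw [← hl]
  refine ⟨fun i => if 0 ≤ g i - l * g' i then b else a, fun i => ?_, ?_⟩
  · by_cases h : 0 ≤ g i - l * g' i <;> simp [h]
  · have key : ∑ i, D i * (g i - l * g' i) ≤
        ∑ i, (if 0 ≤ g i - l * g' i then b else a) * (g i - l * g' i) := by
      refine Finset.sum_le_sum fun i _ => ?_
      split_ifs with h
      · exact mul_le_mul_of_nonneg_right (hD i).2 h
      · exact mul_le_mul_of_nonpos_right (hD i).1 (le_of_lt (not_le.mp h))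
    have expand : ∀ E : Fin t → ℝ, ∑ i, E i * (g i - l * g' i) =
        ∑ i, E i * g i - l * ∑ i, E i * g' i := by
      intro E
      rw [Finset.mul_sum, ← Finset.sum_sub_distrib]
      exact Finset.sum_congr rfl fun i _ => by ring
    rw [expand D, expand (fun i => if 0 ≤ g i - l * g' i then b else a)] at key
    rw [le_div_iff₀]
    · linarith
    · refine Finset.sum_pos (fun i _ => mul_pos ?_ (hg'pos i)) Finset.univ_nonempty
      dsimp only
      split_ifs <;> assumption

/-- The ratio F(C) = CᵀG / CᵀG' can always be (weakly) improved by replacing C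
with a vector whose entries all lie in {c_min, c_max}; in particular, the
maximum of F over vectors with entries in [c_min, c_max] is attained at such a
boundary vector. -/
theorem stmt_16 (t : ℕ) [NeZero t] (C g g' : Fin t → ℝ)
    (hC : ∀ i, C i ∈ Set.Ioc (0:ℝ) 1)
    (hg : ∀ i, g i ∈ Set.Icc (0:ℝ) 1) (hg' : ∀ i, g' i ∈ Set.Icc (0:ℝ) 1)
    (hg'pos : ∀ i, 0 < g' i) :
    (∃ Ct : Fin t → ℝ,
      (∀ i, Ct i = Finset.univ.inf' Finset.univ_nonempty C ∨
            Ct i = Finset.univ.sup' Finset.univ_nonempty C) ∧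
      (∑ i, C i * g i) / (∑ i, C i * g' i) ≤
        (∑ i, Ct i * g i) / (∑ i, Ct i * g' i)) ∧
    (∀ D : Fin t → ℝ,
      (∀ i, D i ∈ Set.Icc (Finset.univ.inf' Finset.univ_nonempty C)
                          (Finset.univ.sup' Finset.univ_nonempty C)) →
      ∃ Ct : Fin t → ℝ,
        (∀ i, Ct i = Finset.univ.inf' Finset.univ_nonempty C ∨
              Ct i = Finset.univ.sup' Finset.univ_nonempty C) ∧
        (∑ i, D i * g i) / (∑ i, D i * g' i) ≤
          (∑ i, Ct i * g i) / (∑ i, Ct i * g' i)) := by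
  have ha : 0 < Finset.univ.inf' Finset.univ_nonempty C := by
    rw [Finset.lt_inf'_iff]
    exact fun i _ => (hC i).1
  refine ⟨boundary_aux _ _ ha C g g' hg'pos fun i => ⟨?_, ?_⟩,
    fun D hD => boundary_aux _ _ ha D g g' hg'pos hD⟩
  · exact Finset.inf'_le _ (Finset.mem_univ i)
  · exact Finset.le_sup' _ (Finset.mem_univ i)
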